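/- Let U be a word over the alphabet {a,b,x} starting and ending with the letter x, and set α = r(U)^{1/(|U|+5)}. Then there exists a constant c > 0 such that f_4(n) ≥ c·α^n for all positive integers n, where f_4(n) is the maximum of r(W) over all words W of length n over the four-letter alphabet {a,b,x,y}. -/

import Mathlib

/-- A single square reduction: a word `U ++ (X ++ X) ++ V` (with `X` nonempty)
is replaced by `U ++ X ++ V`. -/
def Step {α : Type*} (W W' : List α) : Prop :=
  ∃ U X V : List α, X ≠ [] ∧ W = U ++ (X ++ X) ++ V ∧ W' = U ++ X ++ V

/-- `Reaches W W'` : `W'` is obtainable from `W` by a finite sequence of square reductions. -/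
def Reaches {α : Type*} (W W' : List α) : Prop := Relation.ReflTransGen Step W W'

/-- A word is square-free if it contains no square `X ++ X` (with `X` nonempty) as a factor. -/
def SquareFree {α : Type*} (W : List α) : Prop :=
  ∀ X : List α, X ≠ [] → ¬ (X ++ X) <:+: W

/-- The set of square-free reducts of `W`. -/
def Reducts {α : Type*} (W : List α) : Set (List α) := {R | Reaches W R ∧ SquareFree R}

/-! ### Square-free words and reductions -/

theorem SquareFree.of_infix {α : Type*} {W W' : List α} (h : SquareFree W) (h' : W' <:+: W) :
    SquareFree W' := fun X hX hXX => h X hX (hXX.trans h')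

theorem squareFree_singleton {α : Type*} (c : α) : SquareFree [c] := by
  intro X hX h
  have h1 := h.length_le
  have h2 := List.length_pos_iff.2 hX
  simp at h1
  omega

theorem SquareFree.eq_nil_of_suffix_prefix {α : Type*} {A B X : List α} (h : SquareFree (A ++ B))
    (hA : X <:+ A) (hB : X <+: B) : X = [] := by
  by_contra hX
  obtain ⟨C, rfl⟩ := hA
  obtain ⟨D, rfl⟩ := hB
  exact h X hX ⟨C, D, by simp⟩

theorem Step.append_append {α : Type*} {A B : List α} (h : Step A B) (P Q : List α) :
    Step (P ++ A ++ Q) (P ++ B ++ Q) := by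
  obtain ⟨U, X, V, hX, rfl, rfl⟩ := h
  exact ⟨P ++ U, X, V ++ Q, hX, by simp, by simp⟩

theorem Reaches.append_append {α : Type*} {A B : List α} (h : Reaches A B) (P Q : List α) :
    Reaches (P ++ A ++ Q) (P ++ B ++ Q) :=
  by
  induction h with
  | refl => exact Relation.ReflTransGen.refl
  | tail _ h ih => exact ih.tail (h.append_append P Q)

theorem Reaches.append {α : Type*} {A B C D : List α} (h : Reaches A B) (h' : Reaches C D) :
    Reaches (A ++ C) (B ++ D) := by
  have h1 := h.append_append [] C
  have h2 := h'.append_append B []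
  simp only [List.nil_append, List.append_nil] at h1 h2
  exact h1.trans h2

theorem Reaches.subset {α : Type*} {A B : List α} (h : Reaches A B) : B ⊆ A := by
  induction h with
  | refl => exact fun _ h => h
  | tail _ h ih =>
    obtain ⟨U, X, V, -, rfl, rfl⟩ := h
    refine List.Subset.trans ?_ ih
    intro s
    simp

theorem Reaches.head?_eq {α : Type*} {A B : List α} (h : Reaches A B) : B.head? = A.head? := by
  induction h with
  | refl => rfl
  | tail _ h ih =>
    obtain ⟨U, X, V, hX, rfl, rfl⟩ := h
    rw [← ih]
    cases U <;> cases X <;> simp_all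

theorem Reaches.getLast?_eq {α : Type*} {A B : List α} (h : Reaches A B) :
    B.getLast? = A.getLast? := by
  induction h with
  | refl => rfl
  | tail _ h ih =>
    obtain ⟨U, X, V, hX, rfl, rfl⟩ := h
    rw [← ih]
    simp only [List.getLast?_append]
    rcases hX' : X.getLast? with _ | x
    · exact absurd (List.getLast?_eq_none_iff.1 hX') hX
    · simp

theorem Reaches.length_le {α : Type*} {A B : List α} (h : Reaches A B) :
    B.length ≤ A.length := by
  induction h with
  | refl => exact le_rfl
  | tail _ h ih =>
    obtain ⟨U, X, V, -, rfl, rfl⟩ := h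
    simp at ih ⊢
    omega

theorem reaches_replicate_append {α : Type*} (c : α) (w : List α) (t : ℕ) :
    Reaches (List.replicate t c ++ c :: w) (c :: w) := by
  induction t with
  | zero => exact Relation.ReflTransGen.refl
  | succ t ih =>
    have hcomm : List.replicate t c ++ c :: w = c :: (List.replicate t c ++ w) := by
      rw [← List.cons_append, ← List.replicate_succ, List.replicate_succ']
      simp
    refine Relation.ReflTransGen.head ⟨[], [c], List.replicate t c ++ w, by simp, ?_, rfl⟩ ?_
    · rw [List.replicate_succ, List.cons_append, hcomm]; simp
    · rw [hcomm] at ih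
      simpa using! ih

theorem finite_reducts {α : Type*} [Finite α] (W : List α) : (Reducts W).Finite :=
  (List.finite_length_le α W.length).subset fun _ h => h.1.length_le

theorem suffix_append_cases {α : Type*} {X A B : List α} (h : X <:+ A ++ B) :
    X <:+ B ∨ ∃ C, C ≠ [] ∧ X = C ++ B ∧ C <:+ A := by
  obtain ⟨P, hP⟩ := h
  rcases List.append_eq_append_iff.1 hP with ⟨C, rfl, rfl⟩ | ⟨C, rfl, rfl⟩
  · by_cases hC : C = []
    · left; simp [hC]
    · exact Or.inr ⟨C, hC, rfl, ⟨P, rfl⟩⟩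
  · exact Or.inl ⟨C, rfl⟩

theorem prefix_append_cases {α : Type*} {X A B : List α} (h : X <+: A ++ B) :
    X <+: A ∨ ∃ C, C ≠ [] ∧ X = A ++ C ∧ C <+: B := by
  obtain ⟨P, hP⟩ := h
  rcases List.append_eq_append_iff.1 hP with ⟨C, rfl, rfl⟩ | ⟨C, rfl, rfl⟩
  · exact Or.inl ⟨C, rfl⟩
  · by_cases hC : C = []
    · left; simp [hC]
    · exact Or.inr ⟨C, hC, rfl, ⟨P, rfl⟩⟩

/-! ### Separators and separated words -/

/-- Four square-free words of length five over `{a, b, y}`, pairwise distinguished both by their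
prefixes and by their suffixes of length three. -/
def separator : Fin 4 → List (Fin 4)
  | 0 => [3, 0, 1, 0, 3]
  | 1 => [3, 1, 0, 1, 3]
  | 2 => [3, 0, 3, 1, 3]
  | 3 => [3, 1, 3, 0, 3]

theorem length_separator (i : Fin 4) : (separator i).length = 5 := by
  fin_cases i <;> rfl

theorem squareFree_separator (i : Fin 4) : SquareFree (separator i) := by
  intro X hX h
  have hl := h.length_le
  rw [length_separator, List.length_append] at hl
  rcases X with _ | ⟨a, _ | ⟨b, _ | ⟨c, X⟩⟩⟩
  · exact hX rfl
  · revert h a i; decide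
  · revert h a b i; decide
  · simp at hl; omega

theorem two_notMem_separator (i : Fin 4) : 2 ∉ separator i := by
  revert i; decide

theorem separator_eq_cons (i : Fin 4) : ∃ v, separator i = 3 :: v := by
  fin_cases i <;> exact ⟨_, rfl⟩

theorem separator_eq_concat (i : Fin 4) : ∃ v, separator i = v ++ [3] := by
  fin_cases i
  exacts [⟨[3, 0, 1, 0], rfl⟩, ⟨[3, 1, 0, 1], rfl⟩, ⟨[3, 0, 3, 1], rfl⟩, ⟨[3, 1, 3, 0], rfl⟩]

/-- The square-free words over `{a, b, x}` that start and end with `x`. -/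
structure IsFiller (R : List (Fin 4)) : Prop where
  squareFree : SquareFree R
  three_notMem : 3 ∉ R
  head? : R.head? = some 2
  getLast? : R.getLast? = some 2

theorem IsFiller.eq_cons {R : List (Fin 4)} (h : IsFiller R) : ∃ v, R = 2 :: v :=
  List.head?_eq_some_iff.1 h.head?

theorem IsFiller.eq_concat {R : List (Fin 4)} (h : IsFiller R) : ∃ v, R = v ++ [2] :=
  List.getLast?_eq_some_iff.1 h.getLast?

/-- The concatenation of the words `separator i ++ R` for `(i, R)` in the list. -/
def interleave (l : List (Fin 4 × List (Fin 4))) : List (Fin 4) :=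
  l.flatMap fun p => separator p.1 ++ p.2

@[simp] theorem interleave_nil : interleave [] = [] := rfl

@[simp] theorem interleave_cons (p : Fin 4 × List (Fin 4)) (l : List (Fin 4 × List (Fin 4))) :
    interleave (p :: l) = separator p.1 ++ (p.2 ++ interleave l) := by
  simp [interleave]

@[simp] theorem interleave_append (l l' : List (Fin 4 × List (Fin 4))) :
    interleave (l ++ l') = interleave l ++ interleave l' := by
  simp [interleave]

theorem interleave_eq_nil_or_cons (l : List (Fin 4 × List (Fin 4))) :
    interleave l = [] ∨ ∃ v, interleave l = 3 :: v := by
  rcases l with _ | ⟨⟨i, R⟩, l⟩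
  · exact Or.inl rfl
  · obtain ⟨v, hv⟩ := separator_eq_cons i
    exact Or.inr ⟨v ++ (R ++ interleave l), by simp [hv]⟩

theorem interleave_eq_nil_or_concat {l : List (Fin 4 × List (Fin 4))}
    (hl : ∀ p ∈ l, IsFiller p.2) : interleave l = [] ∨ ∃ v, interleave l = v ++ [2] := by
  rcases l.eq_nil_or_concat' with rfl | ⟨l, ⟨i, R⟩, rfl⟩
  · exact Or.inl rfl
  · obtain ⟨v, hv⟩ := (hl (i, R) (by simp)).eq_concat
    simp only at hv
    exact Or.inr ⟨interleave l ++ (separator i ++ v), by simp [hv]⟩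

theorem length_interleave_map (s U : List (Fin 4)) :
    (interleave (s.map fun i => (i, U))).length = s.length * (U.length + 5) := by
  induction s with
  | nil => simp
  | cons i s ih => simp [ih, length_separator]; ring

theorem append_interleave_inj {R R' : List (Fin 4)} {l l' : List (Fin 4 × List (Fin 4))}
    (hR : 3 ∉ R) (hR' : 3 ∉ R') (h : R ++ interleave l = R' ++ interleave l') :
    R = R' ∧ interleave l = interleave l' := by
  have key : ∀ (C : List (Fin 4)) (k : List (Fin 4 × List (Fin 4))), 3 ∉ C →
      ∀ B, interleave k = C ++ B → C = [] := by
    intro C k hC B hB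
    rcases C with _ | ⟨c, C⟩
    · rfl
    · rcases interleave_eq_nil_or_cons k with hk | ⟨v, hk⟩ <;> rw [hk] at hB <;> simp_all
  rcases List.append_eq_append_iff.1 h with ⟨C, rfl, hC⟩ | ⟨C, rfl, hC⟩
  · obtain rfl := key C l (by simp_all) _ hC
    simpa using hC
  · obtain rfl := key C l' (by simp_all) _ hC
    simpa using hC.symm

theorem interleave_injOn {l l' : List (Fin 4 × List (Fin 4))} (hl : ∀ p ∈ l, IsFiller p.2)
    (hl' : ∀ p ∈ l', IsFiller p.2) (hfst : l.map Prod.fst = l'.map Prod.fst)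
    (h : interleave l = interleave l') : l = l' := by
  induction l generalizing l' with
  | nil => simpa using hfst.symm
  | cons p l ih =>
    rcases l' with _ | ⟨p', l'⟩
    · simp at hfst
    · simp only [List.map_cons, List.cons.injEq] at hfst
      rw [interleave_cons, interleave_cons, hfst.1] at h
      obtain ⟨h1, h2⟩ := append_interleave_inj (hl p (by simp)).three_notMem
        (hl' p' (by simp)).three_notMem (List.append_cancel_left h)
      rw [Prod.ext hfst.1 h1, ih (fun q hq => hl q (by simp [hq]))
        (fun q hq => hl' q (by simp [hq])) hfst.2 h2]

theorem reaches_interleave {U : List (Fin 4)} {l : List (Fin 4 × List (Fin 4))}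
    (hl : ∀ p ∈ l, Reaches U p.2) :
    Reaches (interleave ((l.map Prod.fst).map fun i => (i, U))) (interleave l) := by
  induction l with
  | nil => exact Relation.ReflTransGen.refl
  | cons p l ih =>
    simp only [List.map_cons, interleave_cons]
    exact Reaches.append Relation.ReflTransGen.refl
      ((hl p (by simp)).append (ih fun q hq => hl q (by simp [hq])))

theorem interleave_eq_append {l : List (Fin 4 × List (Fin 4))} {M N : List (Fin 4)}
    (h : interleave l = M ++ N) :
    N = [] ∨
    (∃ l₁ i r r' l₂, l = l₁ ++ (i, r ++ r') :: l₂ ∧ r ≠ [] ∧ r' ≠ [] ∧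
      M = interleave l₁ ++ (separator i ++ r) ∧ N = r' ++ interleave l₂) ∨
    ∃ l₁ i R l₂ p q, l = l₁ ++ (i, R) :: l₂ ∧ separator i = p ++ q ∧
      M = interleave l₁ ++ p ∧ N = q ++ (R ++ interleave l₂) := by
  induction l generalizing M with
  | nil => left; simp_all
  | cons x l ih =>
    obtain ⟨i, R⟩ := x
    have lift : ∀ M', interleave l = M' ++ N → M = separator i ++ (R ++ M') → N = [] ∨
        (∃ l₁ i' r r' l₂, (i, R) :: l = l₁ ++ (i', r ++ r') :: l₂ ∧ r ≠ [] ∧ r' ≠ [] ∧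
          M = interleave l₁ ++ (separator i' ++ r) ∧ N = r' ++ interleave l₂) ∨
        ∃ l₁ i' R' l₂ p q, (i, R) :: l = l₁ ++ (i', R') :: l₂ ∧ separator i' = p ++ q ∧
          M = interleave l₁ ++ p ∧ N = q ++ (R' ++ interleave l₂) := by
      rintro M' hM' rfl
      rcases ih hM' with h | ⟨l₁, i', r, r', l₂, rfl, hr, hr', rfl, rfl⟩ |
        ⟨l₁, i', R', l₂, p, q, rfl, hS, rfl, rfl⟩
      · exact Or.inl h
      · exact Or.inr (Or.inl ⟨(i, R) :: l₁, i', r, r', l₂, rfl, hr, hr', by simp, rfl⟩)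
      · exact Or.inr (Or.inr ⟨(i, R) :: l₁, i', R', l₂, p, q, rfl, hS, by simp, rfl⟩)
    rw [interleave_cons] at h
    rcases List.append_eq_append_iff.1 h with ⟨a, rfl, ha⟩ | ⟨c, hc, rfl⟩
    · rcases List.append_eq_append_iff.1 ha with ⟨a', rfl, ha'⟩ | ⟨c, hc, hN⟩
      · exact lift a' ha' rfl
      · by_cases hc0 : c = []
        · subst hc0
          simp only [List.append_nil, List.nil_append] at hc hN
          exact lift [] (by simp [hN]) (by simp [hc])
        by_cases ha0 : a = []
        · subst ha0
          simp only [List.nil_append] at hc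
          exact Or.inr (Or.inr ⟨[], i, R, l, separator i, [], rfl, by simp, by simp,
            by simp [hN, hc]⟩)
        · simp only at hc
          exact Or.inr (Or.inl ⟨[], i, a, c, l, by simp [hc], ha0, hc0, by simp, hN⟩)
    · exact Or.inr (Or.inr ⟨[], i, R, l, M, c, rfl, hc, by simp, rfl⟩)

/-! ### Reading off the separators -/

/-- Apply `g` to all windows of length four, from left to right, and concatenate the outputs. -/
def scan (g : Fin 4 → Fin 4 → Fin 4 → Fin 4 → List (Fin 4)) : List (Fin 4) → List (Fin 4)
  | a :: b :: c :: d :: w => g a b c d ++ scan g (b :: c :: d :: w)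
  | _ => []

theorem scan_prefix (g : Fin 4 → Fin 4 → Fin 4 → Fin 4 → List (Fin 4)) (u v : List (Fin 4)) :
    scan g u <+: scan g (u ++ v) := by
  induction u using scan.induct with
  | case1 a b c d w ih => simpa [scan] using ih
  | case2 u h =>
    rw [scan.eq_2 g u h]
    exact List.nil_prefix

theorem scan_suffix_cons (g : Fin 4 → Fin 4 → Fin 4 → Fin 4 → List (Fin 4)) (a : Fin 4)
    (u : List (Fin 4)) : scan g u <:+ scan g (a :: u) := by
  rcases u with _ | ⟨b, _ | ⟨c, _ | ⟨d, w⟩⟩⟩ <;> simp [scan]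

theorem scan_suffix (g : Fin 4 → Fin 4 → Fin 4 → Fin 4 → List (Fin 4)) (u v : List (Fin 4)) :
    scan g v <:+ scan g (u ++ v) := by
  induction u with
  | nil => exact List.suffix_rfl
  | cons a u ih => exact ih.trans (scan_suffix_cons g a _)

theorem scan_ne_nil_of_infix {g : Fin 4 → Fin 4 → Fin 4 → Fin 4 → List (Fin 4)}
    {u v : List (Fin 4)} (h : u <:+: v) (hu : scan g u ≠ []) : scan g v ≠ [] := by
  obtain ⟨A, B, rfl⟩ := h
  intro h0
  have h1 := scan_prefix g (A ++ u) B
  have h2 := scan_suffix g A u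
  rw [h0, List.prefix_nil] at h1
  rw [h1, List.suffix_nil] at h2
  exact hu h2

theorem scan_cons_of_forall {g : Fin 4 → Fin 4 → Fin 4 → Fin 4 → List (Fin 4)} {a : Fin 4}
    {w : List (Fin 4)} (h : ∀ b c d v, w = b :: c :: d :: v → g a b c d = []) :
    scan g (a :: w) = scan g w := by
  rcases w with _ | ⟨b, _ | ⟨c, _ | ⟨d, w⟩⟩⟩ <;> simp [scan]
  exact h b c d w rfl

/-- Detects the four-letter words `x :: p` with `p` a prefix of a separator. -/
def startMark : Fin 4 → Fin 4 → Fin 4 → Fin 4 → List (Fin 4)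
  | 2, 3, 0, 1 => [0]
  | 2, 3, 1, 0 => [1]
  | 2, 3, 0, 3 => [2]
  | 2, 3, 1, 3 => [3]
  | _, _, _, _ => []

/-- Detects the four-letter words `q ++ [x]` with `q` a suffix of a separator. -/
def endMark : Fin 4 → Fin 4 → Fin 4 → Fin 4 → List (Fin 4)
  | 1, 0, 3, 2 => [0]
  | 0, 1, 3, 2 => [1]
  | 3, 1, 3, 2 => [2]
  | 3, 0, 3, 2 => [3]
  | _, _, _, _ => []

theorem startMark_eq_nil_left {a : Fin 4} (h : a ≠ 2) (b c d : Fin 4) :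
    startMark a b c d = [] := by
  revert a b c d; decide

theorem startMark_eq_nil_right {b : Fin 4} (h : b ≠ 3) (a c d : Fin 4) :
    startMark a b c d = [] := by
  revert a b c d; decide

theorem endMark_eq_nil {c d : Fin 4} (h : c ≠ 3 ∨ d ≠ 2) (a b : Fin 4) :
    endMark a b c d = [] := by
  revert a b c d; decide

theorem scan_startMark_append {u : List (Fin 4)} (hu : 2 ∉ u) (w : List (Fin 4)) :
    scan startMark (u ++ w) = scan startMark w := by
  induction u with
  | nil => rfl
  | cons a u ih =>
    rw [List.cons_append, scan_cons_of_forall, ih (by simp_all)]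
    exact fun b c d _ _ => startMark_eq_nil_left (by rintro rfl; simp at hu) b c d

theorem scan_startMark_concat_append {u : List (Fin 4)} (hu : 3 ∉ u) (w : List (Fin 4)) :
    scan startMark (u ++ 2 :: w) = scan startMark (2 :: w) := by
  induction u with
  | nil => rfl
  | cons a u ih =>
    rw [List.cons_append, scan_cons_of_forall, ih (by simp_all)]
    intro b c d v hv
    apply startMark_eq_nil_right
    rintro rfl
    rcases u with _ | ⟨e, u⟩ <;> simp_all

theorem scan_startMark_eq_nil {u : List (Fin 4)} (hu : 3 ∉ u) : scan startMark u = [] := by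
  induction u with
  | nil => rfl
  | cons a u ih =>
    rw [scan_cons_of_forall, ih (by simp_all)]
    rintro b c d v rfl
    exact startMark_eq_nil_right (by rintro rfl; simp at hu) _ _ _

theorem scan_startMark_separator (i : Fin 4) (w : List (Fin 4)) :
    scan startMark (2 :: (separator i ++ w)) = i :: scan startMark w := by
  have h : scan startMark (2 :: (separator i ++ w)) =
      i :: scan startMark (separator i ++ w) := by
    fin_cases i <;> rfl
  rw [h, scan_startMark_append (two_notMem_separator i)]

theorem scan_startMark_interleave {l : List (Fin 4 × List (Fin 4))}
    (hl : ∀ p ∈ l, IsFiller p.2) (w : List (Fin 4)) :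
    scan startMark (2 :: (interleave l ++ w)) =
      l.map Prod.fst ++ scan startMark (2 :: w) := by
  induction l with
  | nil => rfl
  | cons p l ih =>
    obtain ⟨v, hv⟩ := (hl p (by simp)).eq_concat
    have h3 := (hl p (by simp)).three_notMem
    rw [hv] at h3
    rw [interleave_cons, List.append_assoc, scan_startMark_separator, hv, List.append_assoc,
      List.append_assoc, List.singleton_append, scan_startMark_concat_append (by simp_all),
      ih fun q hq => hl q (by simp [hq])]
    rfl

theorem scan_startMark_prefix {i : Fin 4} {p q : List (Fin 4)} (h : separator i = p ++ q)
    (hp : 3 ≤ p.length) : scan startMark (2 :: p) = [i] := by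
  have hp' : p = (separator i).take p.length := by simp [h]
  have hlen : p.length ≤ 5 := by rw [← length_separator i, h]; simp
  generalize p.length = n at *
  subst hp'
  clear h
  interval_cases n <;> fin_cases i <;> rfl

theorem scan_endMark_append {u w : List (Fin 4)} (hu : 3 ∉ u) (hw : ∀ v, w ≠ 3 :: 2 :: v)
    (hw' : ∀ b v, w ≠ b :: 3 :: 2 :: v) : scan endMark (u ++ w) = scan endMark w := by
  induction u with
  | nil => rfl
  | cons a u ih =>
    rw [List.cons_append, scan_cons_of_forall, ih (by simp_all)]
    intro b c d v hv
    apply endMark_eq_nil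
    by_contra! h
    obtain ⟨rfl, rfl⟩ := h
    rcases u with _ | ⟨e, _ | ⟨f, u⟩⟩ <;> simp_all

theorem scan_endMark_suffix {i : Fin 4} {p q : List (Fin 4)} (h : separator i = p ++ q)
    (hp : p.length ≤ 2) (v : List (Fin 4)) :
    scan endMark (q ++ 2 :: v) = i :: scan endMark (2 :: v) := by
  have hq : q = (separator i).drop p.length := by simp [h]
  generalize p.length = n at *
  subst hq
  clear h
  rcases v with _ | ⟨b, _ | ⟨c, v⟩⟩ <;> interval_cases n <;> fin_cases i <;> rfl

theorem separator_append_ne (i : Fin 4) (w : List (Fin 4)) :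
    (∀ v, separator i ++ w ≠ 3 :: 2 :: v) ∧ ∀ b v, separator i ++ w ≠ b :: 3 :: 2 :: v := by
  fin_cases i <;> simp [separator]

theorem interleave_append_ne {w : List (Fin 4)} (hw : ∀ v, w ≠ 3 :: 2 :: v)
    (hw' : ∀ b v, w ≠ b :: 3 :: 2 :: v) (l : List (Fin 4 × List (Fin 4))) :
    (∀ v, interleave l ++ w ≠ 3 :: 2 :: v) ∧ ∀ b v, interleave l ++ w ≠ b :: 3 :: 2 :: v := by
  rcases l with _ | ⟨p, l⟩
  · exact ⟨hw, hw'⟩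
  · simpa using separator_append_ne p.1 (p.2 ++ (interleave l ++ w))

theorem scan_endMark_interleave {l : List (Fin 4 × List (Fin 4))}
    (hl : ∀ p ∈ l, IsFiller p.2) {w : List (Fin 4)} (hw : ∀ v, w ≠ 3 :: 2 :: v)
    (hw' : ∀ b v, w ≠ b :: 3 :: 2 :: v) :
    scan endMark (interleave l ++ w) = l.map Prod.fst ++ scan endMark w := by
  induction l with
  | nil => rfl
  | cons p l ih =>
    obtain ⟨v, hv⟩ := (hl p (by simp)).eq_cons
    have hne := interleave_append_ne hw hw' l
    rw [interleave_cons, List.append_assoc, hv, List.append_assoc, List.cons_append,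
      scan_endMark_suffix (i := p.1) (p := []) (q := separator p.1) rfl (by simp),
      ← List.cons_append, ← hv,
      scan_endMark_append (hl p (by simp)).three_notMem hne.1 hne.2,
      ih fun q hq => hl q (by simp [hq])]
    rfl

/-! ### Interleaving preserves square-freeness -/

theorem eq_nil_of_mid_filler {l₁ l₂ : List (Fin 4 × List (Fin 4))} {i : Fin 4}
    {r r' X : List (Fin 4)} (hs : SquareFree ((l₁ ++ (i, r ++ r') :: l₂).map Prod.fst))
    (hl : ∀ p ∈ l₁ ++ (i, r ++ r') :: l₂, IsFiller p.2) (hr : r ≠ []) (hr' : r' ≠ [])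
    (hM : X <:+ interleave l₁ ++ (separator i ++ r)) (hN : X <+: r' ++ interleave l₂) :
    X = [] := by
  have hR : IsFiller (r ++ r') := hl (i, r ++ r') (by simp)
  have hl₁ : ∀ p ∈ l₁, IsFiller p.2 := fun p hp => hl p (by simp [hp])
  have hl₂ : ∀ p ∈ l₂, IsFiller p.2 := fun p hp => hl p (by simp [hp])
  have h3 : 3 ∉ r := fun h => hR.three_notMem (by simp [h])
  have h3' : 3 ∉ r' := fun h => hR.three_notMem (by simp [h])
  obtain ⟨t, rfl⟩ : ∃ t, r = 2 :: t := by
    rcases r with _ | ⟨a, t⟩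
    · exact absurd rfl hr
    · exact ⟨t, by simpa using hR.head?⟩
  obtain ⟨t', rfl⟩ : ∃ t', r' = t' ++ [2] := by
    rcases r'.eq_nil_or_concat' with rfl | ⟨t', a, rfl⟩
    · exact absurd rfl hr'
    · have := hR.getLast?
      rw [← List.append_assoc, List.getLast?_concat] at this
      exact ⟨t', by simpa using this⟩
  have hnil : scan startMark X = [] := by
    have hA : scan startMark (2 :: (interleave l₁ ++ (separator i ++ 2 :: t))) =
        l₁.map Prod.fst ++ [i] := by
      rw [scan_startMark_interleave hl₁, scan_startMark_separator, scan_startMark_eq_nil h3]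
    have hB : scan startMark (t' ++ [2] ++ interleave l₂) = l₂.map Prod.fst := by
      have := scan_startMark_interleave hl₂ []
      simp only [List.append_nil] at this
      rw [List.append_assoc, List.singleton_append,
        scan_startMark_concat_append (by simp_all), this]
      simp [scan]
    have hs' : SquareFree ((l₁.map Prod.fst ++ [i]) ++ l₂.map Prod.fst) := by simpa using hs
    apply hs'.eq_nil_of_suffix_prefix
    · obtain ⟨P, hP⟩ := hM.trans (List.suffix_cons 2 _)
      rw [← hA, ← hP]
      exact scan_suffix _ _ _
    · obtain ⟨Q, hQ⟩ := hN
      rw [← hB, ← hQ]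
      exact scan_prefix _ _ _
  rw [← List.append_assoc] at hM
  rcases prefix_append_cases hN with hX | ⟨C, hC, rfl, hCN⟩
  · rcases suffix_append_cases hM with hX' | ⟨D, hD, rfl, hDM⟩
    · exact hR.squareFree.eq_nil_of_suffix_prefix hX' hX
    · obtain ⟨v, hv⟩ := separator_eq_concat i
      rcases D.eq_nil_or_concat' with rfl | ⟨D, d, rfl⟩
      · exact absurd rfl hD
      · rw [hv, ← List.append_assoc] at hDM
        obtain ⟨P, hP⟩ := hDM
        rw [← List.append_assoc] at hP
        obtain rfl : d = 3 := by simpa using (List.append_inj' hP rfl).2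
        exact absurd (hX.subset (by simp)) h3'
  · exfalso
    rcases l₂ with _ | ⟨⟨j, R⟩, l₂⟩
    · simp at hCN; exact hC hCN
    rw [interleave_cons] at hCN
    have h2C : 2 ∉ C := by
      rcases prefix_append_cases hCN with h' | ⟨E, -, rfl, -⟩
      · exact fun h => two_notMem_separator j (h'.subset h)
      · refine absurd hnil (scan_ne_nil_of_infix (u := 2 :: separator j)
          ⟨t', E, by simp⟩ ?_)
        rw [scan_startMark_prefix (i := j) (q := []) (by simp) (by simp [length_separator])]
        simp
    have h3C : 3 ∈ C := by
      obtain ⟨v, hv⟩ := separator_eq_cons j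
      rcases C with _ | ⟨c, C⟩
      · exact absurd rfl hC
      · rw [hv, List.cons_append, List.cons_prefix_cons] at hCN
        simp [hCN.1]
    have hCt : C <:+ 2 :: t ∨ 2 ∈ C := by
      rcases suffix_append_cases ((List.suffix_append (t' ++ [2]) C).trans hM) with
        h | ⟨D, -, rfl, -⟩
      · exact Or.inl h
      · simp
    rcases hCt with h | h
    · exact h3 (h.subset h3C)
    · exact h2C h

theorem eq_nil_of_mid_separator {l₁ l₂ : List (Fin 4 × List (Fin 4))} {i : Fin 4}
    {R p q X : List (Fin 4)} (hs : SquareFree ((l₁ ++ (i, R) :: l₂).map Prod.fst))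
    (hl : ∀ p ∈ l₁ ++ (i, R) :: l₂, IsFiller p.2) (hpq : separator i = p ++ q)
    (hM : X <:+ interleave l₁ ++ p) (hN : X <+: q ++ (R ++ interleave l₂)) :
    X = [] := by
  have hR : IsFiller R := hl (i, R) (by simp)
  have hl₁ : ∀ p ∈ l₁, IsFiller p.2 := fun p hp => hl p (by simp [hp])
  have hl₂ : ∀ p ∈ l₂, IsFiller p.2 := fun p hp => hl p (by simp [hp])
  have h2p : 2 ∉ p := fun h => two_notMem_separator i (by simp [hpq, h])
  have h2q : 2 ∉ q := fun h => two_notMem_separator i (by simp [hpq, h])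
  have hsuff : X <:+ p ∨ ∃ σ, X = σ ++ 2 :: p := by
    rcases suffix_append_cases hM with h | ⟨C, hC, rfl, h⟩
    · exact Or.inl h
    · right
      rcases interleave_eq_nil_or_concat hl₁ with h0 | ⟨v, hv⟩
      · rw [h0] at h; exact absurd (List.suffix_nil.1 h) hC
      · rcases C.eq_nil_or_concat' with rfl | ⟨C, c, rfl⟩
        · exact absurd rfl hC
        · obtain ⟨P, hP⟩ := h
          rw [hv, ← List.append_assoc] at hP
          have := (List.append_inj' hP rfl).2
          exact ⟨C, by simp_all⟩
  have hpref : X <+: q ∨ ∃ τ, X = q ++ 2 :: τ := by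
    rcases prefix_append_cases hN with h | ⟨C, hC, rfl, h⟩
    · exact Or.inl h
    · right
      obtain ⟨v, rfl⟩ := hR.eq_cons
      rcases C with _ | ⟨c, C⟩
      · exact absurd rfl hC
      · rw [List.cons_append, List.cons_prefix_cons] at h
        exact ⟨C, by rw [h.1]⟩
  have h2X : 2 ∉ X := by
    rcases le_or_gt 3 p.length with hp | hp
    · rcases hsuff with h | ⟨σ, rfl⟩
      · exact fun h' => h2p (h.subset h')
      have hA : scan startMark (2 :: (interleave l₁ ++ p)) = l₁.map Prod.fst ++ [i] := by
        rw [scan_startMark_interleave hl₁, scan_startMark_prefix hpq hp]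
      have hB : scan startMark (q ++ (R ++ interleave l₂)) = l₂.map Prod.fst := by
        have := scan_startMark_interleave hl₂ []
        simp only [List.append_nil] at this
        obtain ⟨v, rfl⟩ := hR.eq_concat
        have h3 := hR.three_notMem
        rw [scan_startMark_append h2q, List.append_assoc, List.singleton_append,
          scan_startMark_concat_append (by simp_all), this]
        simp [scan]
      have hs' : SquareFree ((l₁.map Prod.fst ++ [i]) ++ l₂.map Prod.fst) := by simpa using hs
      have hnil : scan startMark (σ ++ 2 :: p) = [] := by
        apply hs'.eq_nil_of_suffix_prefix
        · obtain ⟨P, hP⟩ := hM.trans (List.suffix_cons 2 _)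
          rw [← hA, ← hP]
          exact scan_suffix _ _ _
        · obtain ⟨Q, hQ⟩ := hN
          rw [← hB, ← hQ]
          exact scan_prefix _ _ _
      refine absurd hnil (scan_ne_nil_of_infix (List.suffix_append σ _).isInfix ?_)
      rw [scan_startMark_prefix hpq hp]
      simp
    · rcases hpref with h | ⟨τ, rfl⟩
      · exact fun h' => h2q (h.subset h')
      have hp2 : p.length ≤ 2 := by omega
      have hA : scan endMark (interleave l₁ ++ p) = l₁.map Prod.fst := by
        rw [scan_endMark_interleave hl₁]
        · rcases p with _ | ⟨a, _ | ⟨b, _ | ⟨c, p⟩⟩⟩ <;> simp_all [scan]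
        · rintro v rfl; simp at h2p
        · rintro b v rfl; simp at h2p
      have hB : scan endMark (q ++ (R ++ interleave l₂)) = i :: l₂.map Prod.fst := by
        have := scan_endMark_interleave hl₂ (w := []) (by simp) (by simp)
        have hne := interleave_append_ne (w := []) (by simp) (by simp) l₂
        simp only [List.append_nil] at this hne
        obtain ⟨v, rfl⟩ := hR.eq_cons
        rw [List.cons_append, scan_endMark_suffix hpq hp2, ← List.cons_append,
          scan_endMark_append hR.three_notMem hne.1 hne.2, this]
        simp [scan]
      have hs' : SquareFree (l₁.map Prod.fst ++ (i :: l₂.map Prod.fst)) := by simpa using hs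
      have hnil : scan endMark (q ++ 2 :: τ) = [] := by
        apply hs'.eq_nil_of_suffix_prefix
        · obtain ⟨P, hP⟩ := hM
          rw [← hA, ← hP]
          exact scan_suffix _ _ _
        · obtain ⟨Q, hQ⟩ := hN
          rw [← hB, ← hQ]
          exact scan_prefix _ _ _
      rw [scan_endMark_suffix hpq hp2] at hnil
      simp at hnil
  have hX1 : X <:+ p := hsuff.resolve_right (by rintro ⟨σ, rfl⟩; simp at h2X)
  have hX2 : X <+: q := hpref.resolve_right (by rintro ⟨τ, rfl⟩; simp at h2X)
  exact (hpq ▸ squareFree_separator i).eq_nil_of_suffix_prefix hX1 hX2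

theorem squareFree_interleave {l : List (Fin 4 × List (Fin 4))}
    (hs : SquareFree (l.map Prod.fst)) (hl : ∀ p ∈ l, IsFiller p.2) :
    SquareFree (interleave l) := by
  rintro X hX ⟨P, Q, h⟩
  have h' : interleave l = (P ++ X) ++ (X ++ Q) := by simp [← h]
  rcases interleave_eq_append h' with h0 | ⟨l₁, i, r, r', l₂, rfl, hr, hr', hM, hN⟩ |
    ⟨l₁, i, R, l₂, p, q, rfl, hpq, hM, hN⟩
  · simp at h0; exact hX h0.1
  · exact hX (eq_nil_of_mid_filler hs hl hr hr' ⟨P, hM⟩ ⟨Q, hN⟩)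
  · exact hX (eq_nil_of_mid_separator hs hl hpq ⟨P, hM⟩ ⟨Q, hN⟩)

theorem exists_squareFree_le_length (n : ℕ) :
    ∃ s : List (Fin 4), SquareFree s ∧ n ≤ s.length := by
  induction n with
  | zero => exact ⟨[0], squareFree_singleton 0, by simp⟩
  | succ n ih =>
    obtain ⟨s, hs, hn⟩ := ih
    rcases Nat.eq_zero_or_pos n with rfl | hpos
    · exact ⟨[0], squareFree_singleton 0, by simp⟩
    refine ⟨interleave (s.map fun i => (i, [2])), squareFree_interleave ?_ ?_, ?_⟩
    · simpa [Function.comp_def] using hs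
    · simp only [List.mem_map]
      rintro _ ⟨i, -, rfl⟩
      exact ⟨squareFree_singleton 2, by simp, rfl, rfl⟩
    · rw [length_interleave_map]
      simp
      omega

theorem exists_squareFree_length_eq (n : ℕ) :
    ∃ s : List (Fin 4), SquareFree s ∧ s.length = n := by
  obtain ⟨s, hs, hn⟩ := exists_squareFree_le_length n
  exact ⟨s.take n, hs.of_infix (List.take_prefix n s).isInfix, by simpa using hn⟩

/-! ### Counting reducts -/

theorem isFiller_of_mem_reducts {U R : List (Fin 4)} (hU : ∀ s ∈ U, s ≠ 3)
    (hhead : U.head? = some 2) (hlast : U.getLast? = some 2) (hR : R ∈ Reducts U) :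
    IsFiller R :=
  ⟨hR.2, fun h => hU 3 (hR.1.subset h) rfl, hR.1.head?_eq.trans hhead,
    hR.1.getLast?_eq.trans hlast⟩

theorem ncard_reducts_pow_le {U s : List (Fin 4)} (hU : ∀ s ∈ U, s ≠ 3)
    (hhead : U.head? = some 2) (hlast : U.getLast? = some 2) (hs : SquareFree s)
    (hne : s ≠ []) (t : ℕ) :
    (Reducts U).ncard ^ s.length ≤
      (Reducts (List.replicate t 3 ++ interleave (s.map fun i => (i, U)))).ncard := by
  set W := List.replicate t 3 ++ interleave (s.map fun i => (i, U)) with hW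
  have : Finite (Reducts W) := finite_reducts W
  let pairs (v : Fin s.length → Reducts U) : List (Fin 4 × List (Fin 4)) :=
    List.ofFn fun j => (s[j], (v j : List (Fin 4)))
  have hfst : ∀ v, (pairs v).map Prod.fst = s := fun v => by
    simp [pairs, List.map_ofFn, Function.comp_def]
  have hmem : ∀ v, ∀ p ∈ pairs v, p.2 ∈ Reducts U := by
    intro v p hp
    obtain ⟨j, rfl⟩ := (List.mem_ofFn' _ _).1 hp
    exact (v j).2
  have hfill : ∀ v, ∀ p ∈ pairs v, IsFiller p.2 := fun v p hp =>
    isFiller_of_mem_reducts hU hhead hlast (hmem v p hp)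
  have hred : ∀ v, interleave (pairs v) ∈ Reducts W := by
    intro v
    refine ⟨?_, squareFree_interleave ((hfst v).symm ▸ hs) (hfill v)⟩
    have h1 := reaches_interleave (U := U) fun p hp => (hmem v p hp).1
    rw [hfst v] at h1
    refine Relation.ReflTransGen.trans ?_ h1
    obtain ⟨w, hw⟩ : ∃ w, interleave (s.map fun i => (i, U)) = 3 :: w := by
      rcases s with _ | ⟨i, s⟩
      · exact absurd rfl hne
      · obtain ⟨w, hw⟩ := separator_eq_cons i
        exact ⟨_, by simp [hw]; rfl⟩
    rw [hW, hw]
    exact reaches_replicate_append 3 w t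
  have hinj : Function.Injective fun v => (⟨interleave (pairs v), hred v⟩ : Reducts W) := by
    intro v v' h
    have h1 := interleave_injOn (hfill v) (hfill v') ((hfst v).trans (hfst v').symm)
      (Subtype.ext_iff.1 h)
    have h2 := List.ofFn_injective h1
    funext j
    exact Subtype.ext (Prod.ext_iff.1 (congrFun h2 j)).2
  have hcard := Nat.card_le_card_of_injective _ hinj
  rwa [Nat.card_fun, Nat.card_coe_set_eq, Nat.card_coe_set_eq, Nat.card_fin] at hcard

theorem one_le_ncard_reducts_replicate {n : ℕ} (hn : 0 < n) :
    1 ≤ (Reducts (List.replicate n (3 : Fin 4))).ncard := by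
  refine (Set.ncard_pos (finite_reducts _)).2 ⟨[3], ?_, squareFree_singleton 3⟩
  have h := reaches_replicate_append (3 : Fin 4) [] (n - 1)
  rwa [← List.replicate_succ', Nat.sub_add_cancel hn] at h

theorem inv_mul_rpow_pow_le {r m n : ℕ} (hr : 0 < r) (hm : 0 < m) :
    (r : ℝ)⁻¹ * ((r : ℝ) ^ ((1 : ℝ) / m)) ^ n ≤ (r : ℝ) ^ (n / m) := by
  have hr1 : (1 : ℝ) ≤ r := by exact_mod_cast hr
  have hr0 : (0 : ℝ) < r := by linarith
  have hα : (1 : ℝ) ≤ (r : ℝ) ^ ((1 : ℝ) / m) := Real.one_le_rpow hr1 (by positivity)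
  have hpow : ((r : ℝ) ^ ((1 : ℝ) / m)) ^ m = r := by
    rw [one_div, Real.rpow_inv_natCast_pow hr0.le hm.ne']
  rw [inv_mul_le_iff₀ hr0, ← pow_succ']
  calc ((r : ℝ) ^ ((1 : ℝ) / m)) ^ n
      ≤ ((r : ℝ) ^ ((1 : ℝ) / m)) ^ (m * (n / m + 1)) :=
        pow_le_pow_right₀ hα (Nat.lt_mul_div_succ n hm).le
    _ = (r : ℝ) ^ (n / m + 1) := by rw [pow_mul, hpow]

/-- Let `U` be a word over `{a, b, x}` (inside the four-letter alphabet `Fin 4`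
with `a = 0`, `b = 1`, `x = 2`, `y = 3`) starting and ending with `x`, and let
`α = r(U) ^ (1 / (|U| + 5))`. Then there is a constant `c > 0` such that for every
positive `n` some word of length `n` over the four-letter alphabet has at least
`c * α ^ n` square-free reducts, i.e. `f₄(n) ≥ c * α ^ n`. -/
theorem four_letters_exponential (U : List (Fin 4))
    (hU : ∀ s ∈ U, s ≠ 3)
    (hhead : U.head? = some 2) (hlast : U.getLast? = some 2) :
    ∃ c : ℝ, 0 < c ∧ ∀ n : ℕ, 0 < n →
      ∃ W : List (Fin 4), W.length = n ∧
        c * (((Reducts U).ncard : ℝ) ^ ((1 : ℝ) / (U.length + 5))) ^ n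
          ≤ ((Reducts W).ncard : ℝ) := by
  rcases Nat.eq_zero_or_pos (Reducts U).ncard with h0 | hpos
  · refine ⟨1, one_pos, fun n hn => ⟨List.replicate n 3, by simp, ?_⟩⟩
    rw [h0, Nat.cast_zero, Real.zero_rpow (by positivity), zero_pow hn.ne', mul_zero]
    positivity
  refine ⟨((Reducts U).ncard : ℝ)⁻¹, by positivity, fun n hn => ?_⟩
  have hbound := inv_mul_rpow_pow_le (m := U.length + 5) (n := n) hpos (by omega)
  obtain ⟨s, hs, hlen⟩ := exists_squareFree_length_eq (n / (U.length + 5))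
  suffices h : ∃ W : List (Fin 4), W.length = n ∧
      (Reducts U).ncard ^ (n / (U.length + 5)) ≤ (Reducts W).ncard by
    obtain ⟨W, hW, hle⟩ := h
    refine ⟨W, hW, le_trans ?_ (Nat.cast_le.2 hle)⟩
    push_cast at hbound ⊢
    exact hbound
  by_cases hne : s = []
  · refine ⟨List.replicate n 3, by simp, ?_⟩
    rw [← hlen, hne]
    simpa using one_le_ncard_reducts_replicate hn
  · refine ⟨_, ?_, hlen ▸ ncard_reducts_pow_le hU hhead hlast hs hne (n % (U.length + 5))⟩
    rw [List.length_append, List.length_replicate, length_interleave_map, hlen]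
    rw [Nat.mul_comm]
    exact Nat.mod_add_div _ _
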